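/- arXiv:1701.03545 — 3 statements merged into one kernel-verified Lean document; each statement's English description precedes it below -/
import Mathlib

section
/- Let r > 0 and define a(d,n) = (1 + (k(d,n)·(k(d,n)+d−1))^r)^{−1/2}. Then there exist constants c > 0 and C > 0 depending only on r such that for all integers d ≥ 2: (i) a(d,1) = 1; (ii) for 2 ≤ n ≤ d, c·d^{−r/2} ≤ a(d,n) ≤ C·d^{−r/2}; (iii) for d ≤ n ≤ 2^d, c·d^{−r/2}·(ln(1+d/ln n)/ln n)^{r/2} ≤ a(d,n) ≤ C·d^{−r/2}·(ln(1+d/ln n)/ln n)^{r/2}; (iv) for n ≥ 2^d, c·d^{−r}·n^{−r/d} ≤ a(d,n) ≤ C·d^{−r}·n^{−r/d}. -/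
/-- `C(d,k) = (2k+d)·(k+d−1)!/(k!·d!)`, the dimension of the space of spherical
polynomials of degree at most `k` on the sphere `S^d`, as a real number. -/
noncomputable def sphC (d k : ℕ) : ℝ :=
  ((2 * k + d : ℕ) : ℝ) * (Nat.factorial (k + d - 1) : ℝ) /
    ((Nat.factorial k : ℝ) * (Nat.factorial d : ℝ))

/-- The approximation numbers `a(d,n) = (1 + (k(d,n)·(k(d,n)+d−1))^r)^{−1/2}` of the
embedding `I_d : H^{r,*}(S^d) → L₂(S^d)`, expressed via an index function `kf` with
`kf n = k(d,n)`. -/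
noncomputable def aStar (r : ℝ) (d : ℕ) (kf : ℕ → ℕ) (n : ℕ) : ℝ :=
  (1 + ((kf n : ℝ) * ((kf n : ℝ) + (d : ℝ) - 1)) ^ r) ^ (-(1 / 2) : ℝ)

/-- The lower bound `(1 + m/d)^d ≤ binom(m+d, d)`. -/
theorem one_add_div_pow_le_choose (m d : ℕ) :
    (1 + (m : ℝ) / d) ^ d ≤ ((m + d).choose d : ℝ) := by
  induction d with
  | zero => simp
  | succ d ih =>
    have hrec : (((m + d : ℕ) : ℝ) + 1) * ((m + d).choose d : ℝ) =
        ((m + (d + 1)).choose (d + 1) : ℝ) * ((d : ℝ) + 1) := by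
      exact_mod_cast Nat.add_one_mul_choose_eq (m + d) d
    have hd : (0 : ℝ) < (d : ℝ) + 1 := by positivity
    have hmono : (1 + (m : ℝ) / ((d : ℝ) + 1)) ^ d ≤ (1 + (m : ℝ) / d) ^ d := by
      rcases Nat.eq_zero_or_pos d with rfl | hpos
      · simp
      · have : (0 : ℝ) < d := by exact_mod_cast hpos
        gcongr
        linarith
    have heq : ((m + (d + 1)).choose (d + 1) : ℝ) =
        (1 + (m : ℝ) / ((d : ℝ) + 1)) * ((m + d).choose d : ℝ) := by
      field_simp
      push_cast at hrec
      linarith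
    rw [heq, pow_succ, mul_comm]
    push_cast
    exact mul_le_mul_of_nonneg_left (hmono.trans ih) (by positivity)

theorem choose_mul_pow_le_exp (a b : ℕ) (hab : b ≤ a) {s : ℝ} (hs : 0 ≤ s) :
    (a.choose b : ℝ) * s ^ b ≤ Real.exp (a * s) := by
  have hsum : (s + 1) ^ a = ∑ i ∈ Finset.range (a + 1), s ^ i * (a.choose i : ℝ) := by
    simp [add_pow]
  have hterm : s ^ b * (a.choose b : ℝ) ≤ (s + 1) ^ a := by
    rw [hsum]
    exact Finset.single_le_sum (f := fun i => s ^ i * (a.choose i : ℝ))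
      (fun i _ => by positivity) (Finset.mem_range.2 (by omega))
  calc (a.choose b : ℝ) * s ^ b = s ^ b * (a.choose b : ℝ) := mul_comm _ _
    _ ≤ (s + 1) ^ a := hterm
    _ ≤ Real.exp s ^ a := by gcongr; exact Real.add_one_le_exp s
    _ = Real.exp (a * s) := (Real.exp_nat_mul s a).symm

theorem sphC_mul_eq {d : ℕ} (hd : 1 ≤ d) (k : ℕ) :
    sphC d k * ((k : ℝ) + d) = (2 * k + d) * ((k + d).choose d : ℝ) := by
  have hfac : ((k + d).choose d : ℝ) * (k.factorial * d.factorial) =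
      ((k : ℝ) + d) * ((k + d - 1).factorial : ℝ) := by
    have h1 := Nat.add_choose_mul_factorial_mul_factorial k d
    have h2 := Nat.mul_factorial_pred (show k + d ≠ 0 by omega)
    rw [← h2, mul_assoc] at h1
    exact_mod_cast h1
  have hk : (k.factorial : ℝ) ≠ 0 := by positivity
  have hd' : (d.factorial : ℝ) ≠ 0 := by positivity
  unfold sphC
  rw [div_mul_eq_mul_div, div_eq_iff (by positivity)]
  push_cast
  linear_combination (-(2 * (k : ℝ) + d)) * hfac

theorem choose_le_sphC {d : ℕ} (hd : 1 ≤ d) (k : ℕ) :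
    ((k + d).choose d : ℝ) ≤ sphC d k := by
  have hd' : (1 : ℝ) ≤ d := by exact_mod_cast hd
  have hk : (0 : ℝ) ≤ k := k.cast_nonneg
  have h := sphC_mul_eq hd k
  have hc : (0 : ℝ) ≤ ((k + d).choose d : ℝ) := by positivity
  refine le_of_mul_le_mul_right ?_ (show (0 : ℝ) < (k : ℝ) + d by linarith)
  nlinarith [mul_nonneg hk hc]

theorem sphC_le_two_mul_choose {d : ℕ} (hd : 1 ≤ d) (k : ℕ) :
    sphC d k ≤ 2 * ((k + d).choose d : ℝ) := by
  have hd' : (1 : ℝ) ≤ d := by exact_mod_cast hd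
  have hk : (0 : ℝ) ≤ k := k.cast_nonneg
  have h := sphC_mul_eq hd k
  have hc : (0 : ℝ) ≤ ((k + d).choose d : ℝ) := by positivity
  refine le_of_mul_le_mul_right ?_ (show (0 : ℝ) < (k : ℝ) + d by linarith)
  nlinarith [mul_nonneg (show (0 : ℝ) ≤ d by linarith) hc]

theorem sphC_zero {d : ℕ} (hd : 1 ≤ d) : sphC d 0 = 1 := by
  have hd' : (d : ℝ) ≠ 0 := by positivity
  have h := sphC_mul_eq hd 0
  simp only [Nat.cast_zero, zero_add, Nat.choose_self, mul_zero, Nat.cast_one] at h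
  exact mul_right_cancel₀ hd' (by linarith)

/-- Entropy upper bound for `sphC`, with a free parameter `s > 0`. -/
theorem log_sphC_le {d k : ℕ} (hd : 1 ≤ d) {s : ℝ} (hs : 0 < s) :
    Real.log (sphC d k) ≤ Real.log 2 + k * Real.log (1 / s) + (k + d) * s := by
  have hcpos : (0 : ℝ) < ((k + d).choose k : ℝ) := by
    exact_mod_cast Nat.choose_pos (Nat.le_add_right k d)
  have hup := sphC_le_two_mul_choose hd k
  have hlow := choose_le_sphC hd k
  rw [← Nat.choose_symm_add] at hup hlow
  have hexp := choose_mul_pow_le_exp (k + d) k (Nat.le_add_right k d) hs.le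
  have hlog := Real.log_le_log (by positivity) hexp
  rw [Real.log_exp, Real.log_mul hcpos.ne' (by positivity), Real.log_pow] at hlog
  have hlog2 := Real.log_le_log (hcpos.trans_le hlow) hup
  rw [Real.log_mul two_ne_zero hcpos.ne'] at hlog2
  rw [one_div, Real.log_inv]
  push_cast at hlog
  linarith

/-- `k` is the index `k(d,n)` of the dimension interval containing `n`. -/
def IsSphIndex (d n k : ℕ) : Prop :=
  (n : ℝ) ≤ sphC d k ∧ (0 < k → sphC d (k - 1) < (n : ℝ))

/-- The eigenvalue `k(k+d-1)` of the Laplace–Beltrami operator. -/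
def sphEig (d k : ℕ) : ℝ := (k : ℝ) * ((k : ℝ) + (d : ℝ) - 1)

theorem IsSphIndex.one_le {d n k : ℕ} (hd : 1 ≤ d) (hn : 2 ≤ n) (h : IsSphIndex d n k) :
    1 ≤ k := by
  rcases Nat.eq_zero_or_pos k with rfl | hk
  · have h1 := h.1
    rw [sphC_zero hd] at h1
    have : n ≤ 1 := by exact_mod_cast h1
    omega
  · exact hk

theorem IsSphIndex.choose_lt {d n m : ℕ} (hd : 1 ≤ d) (h : IsSphIndex d n (m + 1)) :
    ((m + d).choose d : ℝ) < n :=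
  (choose_le_sphC hd m).trans_lt (h.2 m.succ_pos)

theorem IsSphIndex.eq_zero {d k : ℕ} (hd : 1 ≤ d) (h : IsSphIndex d 1 k) : k = 0 := by
  rcases k with _ | m
  · rfl
  · have h1 := h.choose_lt hd
    have h2 : 0 < (m + d).choose d := Nat.choose_pos (Nat.le_add_left d m)
    have h3 : (m + d).choose d < 1 := by exact_mod_cast h1
    omega

theorem IsSphIndex.eq_one {d n k : ℕ} (hd : 1 ≤ d) (hn : 2 ≤ n) (hnd : n ≤ d)
    (h : IsSphIndex d n k) : k = 1 := by
  have hk := h.one_le hd hn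
  obtain ⟨m, rfl⟩ : ∃ m, k = m + 1 := ⟨k - 1, by omega⟩
  rcases m with _ | m
  · rfl
  · exfalso
    have h1 : (m + 1 + d).choose d < n := by exact_mod_cast h.choose_lt hd
    have h2 : (1 + d).choose d ≤ (m + 1 + d).choose d := Nat.choose_le_choose d (by omega)
    rw [add_comm 1 d, Nat.choose_succ_self_right] at h2
    omega

theorem log_one_add_div_log_pos {d n : ℕ} (hd : 2 ≤ d) (hn : 2 ≤ n) :
    0 < Real.log (1 + (d : ℝ) / Real.log n) := by
  have hL : 0 < Real.log n := Real.log_pos (by exact_mod_cast hn)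
  have hd' : (0 : ℝ) < d := by positivity
  exact Real.log_pos (by linarith [div_pos hd' hL])

theorem log_nat_le_of_le_two_pow {d n : ℕ} (hn : 1 ≤ n) (hnd : n ≤ 2 ^ d) :
    Real.log n ≤ d * Real.log 2 := by
  have hpow : (n : ℝ) ≤ 2 ^ d := by exact_mod_cast hnd
  have h := Real.log_le_log (by positivity) hpow
  rwa [Real.log_pow] at h

/-- In the preasymptotic range, `k(d,n)` is at least of order `ln n / ln(1 + d / ln n)`. -/
theorem IsSphIndex.log_le_mul {d n k : ℕ} (hd : 2 ≤ d) (hn : 2 ≤ n) (hnd : n ≤ 2 ^ d)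
    (h : IsSphIndex d n k) :
    3 * Real.log n ≤ 20 * (k * Real.log (1 + (d : ℝ) / Real.log n)) := by
  have hk : (1 : ℝ) ≤ k := by exact_mod_cast h.one_le (by omega) hn
  have hL : 0 < Real.log n := Real.log_pos (by exact_mod_cast hn)
  have hLd := log_nat_le_of_le_two_pow (by omega) hnd
  have hd' : (0 : ℝ) < d := by positivity
  have hlt := Real.log_two_lt_d9
  have hgt := Real.log_two_gt_d9
  have hT : 1 ≤ (d : ℝ) / Real.log n := by
    rw [one_le_div hL]
    nlinarith
  have hdT : (d : ℝ) / Real.log n * Real.log n = d := div_mul_cancel₀ _ hL.ne'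
  generalize (d : ℝ) / Real.log n = T at hT hdT ⊢
  have hℓ : Real.log 2 ≤ Real.log (1 + T) := Real.log_le_log two_pos (by linarith)
  have hs : 0 < 1 / (4 * (1 + T)) := by positivity
  have hub := log_sphC_le (k := k) (show 1 ≤ d by omega) hs
  have hns := Real.log_le_log (show (0 : ℝ) < n by positivity) h.1
  have hlog4 : Real.log 4 = 2 * Real.log 2 := by
    rw [show (4 : ℝ) = 2 ^ 2 by norm_num, Real.log_pow]; norm_num
  rw [one_div_one_div, Real.log_mul (by norm_num) (by positivity), hlog4] at hub
  have hs8 : 1 / (4 * (1 + T)) ≤ 1 / 8 := by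
    apply one_div_le_one_div_of_le <;> linarith
  have hds : (d : ℝ) * (1 / (4 * (1 + T))) ≤ Real.log n / 4 := by
    rw [mul_one_div, div_le_iff₀ (by positivity), ← hdT]
    nlinarith
  have hks : (k : ℝ) * (1 / (4 * (1 + T))) ≤ k * (1 / 8) :=
    mul_le_mul_of_nonneg_left hs8 (by linarith)
  have hkl : (k : ℝ) * Real.log 2 ≤ k * Real.log (1 + T) :=
    mul_le_mul_of_nonneg_left hℓ (by linarith)
  nlinarith

theorem log_one_add_div_log_le {d n : ℕ} (hd : 2 ≤ d) (hdn : d ≤ n) :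
    Real.log (1 + (d : ℝ) / Real.log n) ≤ 3 * Real.log n := by
  have hd' : (2 : ℝ) ≤ d := by exact_mod_cast hd
  have hdn' : (d : ℝ) ≤ n := by exact_mod_cast hdn
  have hgt := Real.log_two_gt_d9
  have hL2 : Real.log 2 ≤ Real.log n := Real.log_le_log two_pos (by linarith)
  have hLd : Real.log d ≤ Real.log n := Real.log_le_log (by linarith) hdn'
  have hT : (d : ℝ) / Real.log n ≤ 2 * d := by
    rw [div_le_iff₀ (by linarith)]
    nlinarith
  have hT0 : 0 ≤ (d : ℝ) / Real.log n := div_nonneg (by linarith) (by linarith)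
  have hle : 1 + (d : ℝ) / Real.log n ≤ (d : ℝ) ^ 3 := by
    nlinarith [mul_nonneg (sub_nonneg.2 hd') (sub_nonneg.2 hd'), sq_nonneg (d : ℝ)]
  have h := Real.log_le_log (by linarith) hle
  rw [Real.log_pow] at h
  push_cast at h
  linarith

/-- If `binom(m+d, d) < n ≤ 2^d`, then `m < d`. -/
theorem lt_of_choose_lt_two_pow {d n m : ℕ} (hd : 1 ≤ d) (hnd : n ≤ 2 ^ d)
    (h : ((m + d).choose d : ℝ) < n) : m < d := by
  by_contra! hdm
  have hd' : (0 : ℝ) < d := by positivity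
  have h1 : (1 : ℝ) ≤ (m : ℝ) / d := by
    rw [one_le_div hd']; exact_mod_cast hdm
  have h2 : (2 : ℝ) ^ d ≤ (1 + (m : ℝ) / d) ^ d := by
    gcongr; linarith
  have h3 : (n : ℝ) ≤ 2 ^ d := by exact_mod_cast hnd
  linarith [one_add_div_pow_le_choose m d]

theorem mul_log_le_of_choose_lt {d n m : ℕ} (hd : 2 ≤ d) (hn : 2 ≤ n) (hnd : n ≤ 2 ^ d)
    (h : ((m + d).choose d : ℝ) < n) :
    m * Real.log (1 + (d : ℝ) / Real.log n) ≤ 2 * Real.log n := by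
  have hL : 0 < Real.log n := Real.log_pos (by exact_mod_cast hn)
  rcases Nat.eq_zero_or_pos m with rfl | hm
  · simp [hL.le]
  have hmd := lt_of_choose_lt_two_pow (by omega) hnd h
  have hm' : (0 : ℝ) < m := by exact_mod_cast hm
  have hmd' : (m : ℝ) < d := by exact_mod_cast hmd
  have hgt := Real.log_two_gt_d9
  have hlow := one_add_div_pow_le_choose d m
  rw [add_comm d m, Nat.choose_symm_add] at hlow
  have hone : 1 ≤ (d : ℝ) / m := (one_le_div hm').2 hmd'.le
  have hlog := Real.log_le_log (by positivity) (hlow.trans h.le)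
  rw [Real.log_pow] at hlog
  have hlog2 : Real.log 2 ≤ Real.log (1 + (d : ℝ) / m) :=
    Real.log_le_log two_pos (by linarith)
  have hmL : (m : ℝ) ≤ 2 * Real.log n := by nlinarith
  have hTm : (d : ℝ) / Real.log n / 2 ≤ (d : ℝ) / m := by
    rw [div_div]
    exact div_le_div_of_nonneg_left (by linarith) hm' (by linarith)
  have hT0 : 0 < (d : ℝ) / Real.log n := div_pos (by linarith) hL
  have hsq : Real.log (1 + (d : ℝ) / Real.log n) ≤ 2 * Real.log (1 + (d : ℝ) / m) := by
    have hle : 1 + (d : ℝ) / Real.log n ≤ (1 + (d : ℝ) / m) ^ 2 := by nlinarith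
    have := Real.log_le_log (by linarith) hle
    rw [Real.log_pow] at this
    exact_mod_cast this
  nlinarith

/-- In the preasymptotic range, the eigenvalue is of exact order `d ln n / ln(1 + d / ln n)`. -/
theorem IsSphIndex.sphEig_bounds_preasymptotic {d n k : ℕ} (hd : 2 ≤ d) (hdn : d ≤ n)
    (hnd : n ≤ 2 ^ d) (h : IsSphIndex d n k) :
    3 / 20 * (d * (Real.log n / Real.log (1 + (d : ℝ) / Real.log n))) ≤ sphEig d k ∧
      sphEig d k ≤ 10 * (d * (Real.log n / Real.log (1 + (d : ℝ) / Real.log n))) := by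
  have hn : 2 ≤ n := hd.trans hdn
  have hd' : (2 : ℝ) ≤ d := by exact_mod_cast hd
  have hℓ := log_one_add_div_log_pos hd hn
  have hk := h.one_le (by omega) hn
  have hlow := h.log_le_mul hd hn hnd
  have hbase := log_one_add_div_log_le hd hdn
  obtain ⟨m, rfl⟩ : ∃ m, k = m + 1 := ⟨k - 1, by omega⟩
  have hlt := h.choose_lt (by omega)
  have hup := mul_log_le_of_choose_lt hd hn hnd hlt
  have hmd : (m : ℝ) ≤ d := by exact_mod_cast (lt_of_choose_lt_two_pow (by omega) hnd hlt).le
  have hm0 : (0 : ℝ) ≤ m := m.cast_nonneg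
  unfold sphEig
  push_cast at hlow ⊢
  generalize Real.log (1 + (d : ℝ) / Real.log n) = ℓ at *
  have h1 : 3 / 20 * (Real.log n / ℓ) ≤ m + 1 := by
    rw [← mul_div_assoc, div_le_iff₀ hℓ]; linarith
  have h2 : (m : ℝ) + 1 ≤ 5 * (Real.log n / ℓ) := by
    rw [← mul_div_assoc, le_div_iff₀ hℓ]; linarith
  constructor
  · nlinarith
  · nlinarith

/-- In the asymptotic range, the eigenvalue is of exact order `d² n^{2/d}`. -/
theorem IsSphIndex.sphEig_bounds_asymptotic {d n k : ℕ} (hd : 2 ≤ d) (hnd : 2 ^ d ≤ n)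
    (h : IsSphIndex d n k) :
    1 / 1764 * (d * (n : ℝ) ^ ((1 : ℝ) / d)) ^ 2 ≤ sphEig d k ∧
      sphEig d k ≤ 1 * (d * (n : ℝ) ^ ((1 : ℝ) / d)) ^ 2 := by
  have hn : 2 ≤ n := le_trans (Nat.le_self_pow (by omega) 2) hnd
  have hd' : (2 : ℝ) ≤ d := by exact_mod_cast hd
  have hk := h.one_le (by omega) hn
  have hk' : (1 : ℝ) ≤ k := by exact_mod_cast hk
  have hn0 : (0 : ℝ) < n := by positivity
  have hN0 : 0 < (n : ℝ) ^ ((1 : ℝ) / d) := by positivity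
  have hNd : ((n : ℝ) ^ ((1 : ℝ) / d)) ^ d = n := by
    rw [one_div]; exact Real.rpow_inv_natCast_pow hn0.le (by omega)
  generalize (n : ℝ) ^ ((1 : ℝ) / d) = N at hN0 hNd ⊢
  constructor
  · have hkd : (d : ℝ) ≤ 6 * k := by
      have hub := log_sphC_le (k := k) (show 1 ≤ d by omega) (show (0 : ℝ) < 1 / 8 by norm_num)
      have hns := Real.log_le_log hn0 h.1
      have hpow : (2 : ℝ) ^ d ≤ n := by exact_mod_cast hnd
      have hlog := Real.log_le_log (by positivity) hpow
      have hlog8 : Real.log 8 = 3 * Real.log 2 := by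
        rw [show (8 : ℝ) = 2 ^ 3 by norm_num, Real.log_pow]; norm_num
      rw [Real.log_pow] at hlog
      rw [one_div_one_div, hlog8] at hub
      have hlt := Real.log_two_lt_d9
      have hgt := Real.log_two_gt_d9
      nlinarith
    have hroot : N ≤ 2 * (Real.exp 1 * ((k + d) / d)) := by
      have hs : (0 : ℝ) ≤ d / (k + d) := by positivity
      have hexp := choose_mul_pow_le_exp (k + d) d (Nat.le_add_left d k) hs
      have harg : ((k + d : ℕ) : ℝ) * (d / (k + d)) = d * 1 := by
        push_cast; field_simp
      rw [harg, Real.exp_nat_mul] at hexp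
      have hch : ((k + d).choose d : ℝ) ≤ (Real.exp 1 * ((k + d) / d)) ^ d := by
        have hpos : (0 : ℝ) < (d / (k + d)) ^ d := by positivity
        rw [← inv_div (d : ℝ), mul_pow, inv_pow, ← div_eq_mul_inv, le_div_iff₀ hpos]
        exact hexp
      refine le_of_pow_le_pow_left₀ (show d ≠ 0 by omega) (by positivity) ?_
      rw [hNd, mul_pow]
      have h2 : (2 : ℝ) ≤ 2 ^ d := le_self_pow₀ one_le_two (by omega)
      calc (n : ℝ) ≤ 2 * ((k + d).choose d : ℝ) :=
            h.1.trans (sphC_le_two_mul_choose (by omega) k)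
        _ ≤ _ := by gcongr
    have hdN : d * N ≤ 42 * k := by
      have he := Real.exp_one_lt_d9
      have hmul : d * N ≤ d * (2 * (Real.exp 1 * ((k + d) / d))) :=
        mul_le_mul_of_nonneg_left hroot (by linarith)
      have heq : d * (2 * (Real.exp 1 * (((k : ℝ) + d) / d))) = 2 * Real.exp 1 * (k + d) := by
        field_simp
      rw [heq] at hmul
      nlinarith
    have hsq : (d * N) ^ 2 ≤ (42 * k) ^ 2 := by gcongr
    unfold sphEig
    nlinarith
  · obtain ⟨m, rfl⟩ : ∃ m, k = m + 1 := ⟨k - 1, by omega⟩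
    have hle := (one_add_div_pow_le_choose m d).trans (h.choose_lt (by omega)).le
    rw [← hNd] at hle
    have hroot := le_of_pow_le_pow_left₀ (show d ≠ 0 by omega) hN0.le hle
    have hm0 : (0 : ℝ) ≤ m := m.cast_nonneg
    have hmd : (m : ℝ) + d ≤ d * N := by
      have := mul_le_mul_of_nonneg_left hroot (show (0 : ℝ) ≤ d by linarith)
      rwa [mul_add, mul_one, mul_div_cancel₀ _ (by linarith), add_comm] at this
    unfold sphEig
    push_cast
    rw [one_mul, sq]
    exact mul_le_mul (by linarith) (by linarith) (by linarith) (by linarith)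

/-- Two-sided bounds on `x ≥ 1` transfer to `(1 + x^r)^{-1/2}`. -/
theorem one_add_rpow_neg_half_bounds {r A B x y : ℝ} (hr : 0 < r) (hA : 0 < A) (hB : 0 < B)
    (hx : 1 ≤ x) (hy : 0 < y) (hAx : A * y ≤ x) (hxB : x ≤ B * y) :
    (2 : ℝ) ^ (-(1 / 2) : ℝ) * B ^ (-(r / 2)) * y ^ (-(r / 2)) ≤
        (1 + x ^ r) ^ (-(1 / 2) : ℝ) ∧
      (1 + x ^ r) ^ (-(1 / 2) : ℝ) ≤ A ^ (-(r / 2)) * y ^ (-(r / 2)) := by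
  have hx0 : 0 < x := by linarith
  have hxr : 1 ≤ x ^ r := Real.one_le_rpow hx hr.le
  have hhalf : (x ^ r) ^ (-(1 / 2) : ℝ) = x ^ (-(r / 2)) := by
    rw [← Real.rpow_mul hx0.le]; congr 1; ring
  have hneg : -(r / 2) ≤ 0 := by linarith
  constructor
  · calc (2 : ℝ) ^ (-(1 / 2) : ℝ) * B ^ (-(r / 2)) * y ^ (-(r / 2))
        = (2 : ℝ) ^ (-(1 / 2) : ℝ) * (B * y) ^ (-(r / 2)) := by
          rw [Real.mul_rpow hB.le hy.le, mul_assoc]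
      _ ≤ (2 : ℝ) ^ (-(1 / 2) : ℝ) * x ^ (-(r / 2)) :=
          mul_le_mul_of_nonneg_left (Real.rpow_le_rpow_of_nonpos hx0 hxB hneg) (by positivity)
      _ = (2 * x ^ r) ^ (-(1 / 2) : ℝ) := by
          rw [Real.mul_rpow two_pos.le (by positivity), hhalf]
      _ ≤ (1 + x ^ r) ^ (-(1 / 2) : ℝ) :=
          Real.rpow_le_rpow_of_nonpos (by positivity) (by linarith) (by norm_num)
  · calc (1 + x ^ r) ^ (-(1 / 2) : ℝ) ≤ (x ^ r) ^ (-(1 / 2) : ℝ) :=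
          Real.rpow_le_rpow_of_nonpos (by positivity) (by linarith) (by norm_num)
      _ = x ^ (-(r / 2)) := hhalf
      _ ≤ (A * y) ^ (-(r / 2)) := Real.rpow_le_rpow_of_nonpos (by positivity) hAx hneg
      _ = A ^ (-(r / 2)) * y ^ (-(r / 2)) := Real.mul_rpow hA.le hy.le

theorem one_le_sphEig {d k : ℕ} (hd : 1 ≤ d) (hk : 1 ≤ k) : 1 ≤ sphEig d k := by
  have hd' : (1 : ℝ) ≤ d := by exact_mod_cast hd
  have hk' : (1 : ℝ) ≤ k := by exact_mod_cast hk
  unfold sphEig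
  nlinarith

/-- A common pair of constants for the three ranges of `n`. -/
theorem aStar_bounds {r : ℝ} (hr : 0 < r) {d n : ℕ} {kf : ℕ → ℕ} {y : ℝ}
    (hd : 1 ≤ d) (hk : 1 ≤ kf n) (hy : 0 < y) (hlow : 1 / 1764 * y ≤ sphEig d (kf n))
    (hup : sphEig d (kf n) ≤ 10 * y) :
    (2 : ℝ) ^ (-(1 / 2) : ℝ) * 10 ^ (-(r / 2)) * y ^ (-(r / 2)) ≤ aStar r d kf n ∧
      aStar r d kf n ≤ (1 / 1764) ^ (-(r / 2)) * y ^ (-(r / 2)) :=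
  one_add_rpow_neg_half_bounds hr (by norm_num) (by norm_num) (one_le_sphEig hd hk) hy hlow hup

/-- Theorem 4.1: preasymptotics and asymptotics of
`a_n(I_d : H^{r,*}(S^d) → L₂(S^d))`, with constants depending only on `r`. -/
theorem sobolev_star_sphere_asymptotics (r : ℝ) (hr : 0 < r) :
    ∃ c C : ℝ, 0 < c ∧ 0 < C ∧
      ∀ d : ℕ, 2 ≤ d → ∀ kf : ℕ → ℕ,
        (∀ n : ℕ, 1 ≤ n →
          (n : ℝ) ≤ sphC d (kf n) ∧ (0 < kf n → sphC d (kf n - 1) < (n : ℝ))) →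
        (aStar r d kf 1 = 1) ∧
        (∀ n : ℕ, 2 ≤ n → n ≤ d →
          c * (d : ℝ) ^ (-(r / 2)) ≤ aStar r d kf n ∧
          aStar r d kf n ≤ C * (d : ℝ) ^ (-(r / 2))) ∧
        (∀ n : ℕ, d ≤ n → n ≤ 2 ^ d →
          c * (d : ℝ) ^ (-(r / 2)) *
              (Real.log (1 + (d : ℝ) / Real.log n) / Real.log n) ^ (r / 2) ≤ aStar r d kf n ∧
          aStar r d kf n ≤
            C * (d : ℝ) ^ (-(r / 2)) *
              (Real.log (1 + (d : ℝ) / Real.log n) / Real.log n) ^ (r / 2)) ∧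
        (∀ n : ℕ, 2 ^ d ≤ n →
          c * (d : ℝ) ^ (-r) * (n : ℝ) ^ (-(r / (d : ℝ))) ≤ aStar r d kf n ∧
          aStar r d kf n ≤ C * (d : ℝ) ^ (-r) * (n : ℝ) ^ (-(r / (d : ℝ)))) := by
  refine ⟨(2 : ℝ) ^ (-(1 / 2) : ℝ) * 10 ^ (-(r / 2)), (1 / 1764) ^ (-(r / 2)),
    by positivity, by positivity, ?_⟩
  intro d hd kf hkf
  have hidx : ∀ n, 1 ≤ n → IsSphIndex d n (kf n) := hkf
  have hd1 : 1 ≤ d := by omega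
  have hd0 : (0 : ℝ) < d := by positivity
  refine ⟨?_, ?_, ?_, ?_⟩
  · have h0 := (hidx 1 le_rfl).eq_zero hd1
    simp [aStar, h0, Real.zero_rpow hr.ne']
  · intro n hn hnd
    have hk := (hidx n (by omega)).eq_one hd1 hn hnd
    have heig : sphEig d (kf n) = d := by
      rw [hk]; simp [sphEig]
    exact aStar_bounds hr hd1 hk.ge hd0 (by rw [heig]; linarith) (by rw [heig]; linarith)
  · intro n hdn hnd
    have hn : 2 ≤ n := hd.trans hdn
    have hL : 0 < Real.log n := Real.log_pos (by exact_mod_cast hn)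
    have hℓ := log_one_add_div_log_pos hd hn
    have hi := hidx n (by omega)
    have hb := hi.sphEig_bounds_preasymptotic hd hdn hnd
    generalize Real.log (1 + (d : ℝ) / Real.log n) = ℓ at *
    have hy : 0 < d * (Real.log n / ℓ) := by positivity
    have h := aStar_bounds hr hd1 (hi.one_le hd1 hn) hy (by linarith) hb.2
    have hpow : (d * (Real.log n / ℓ)) ^ (-(r / 2)) =
        (d : ℝ) ^ (-(r / 2)) * (ℓ / Real.log n) ^ (r / 2) := by
      rw [Real.mul_rpow hd0.le (by positivity), Real.rpow_neg (by positivity : 0 ≤ Real.log n / ℓ),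
        ← Real.inv_rpow (by positivity), inv_div]
    rw [hpow, ← mul_assoc, ← mul_assoc] at h
    exact h
  · intro n hnd
    have hn : 2 ≤ n := le_trans (Nat.le_self_pow (by omega) 2) hnd
    have hn0 : (0 : ℝ) < n := by positivity
    have hi := hidx n (by omega)
    have hb := hi.sphEig_bounds_asymptotic hd hnd
    have hy : 0 < (d * (n : ℝ) ^ ((1 : ℝ) / d)) ^ 2 := by positivity
    have h := aStar_bounds hr hd1 (hi.one_le hd1 hn) hy hb.1 (by linarith)
    have hpow : ((d * (n : ℝ) ^ ((1 : ℝ) / d)) ^ 2) ^ (-(r / 2)) =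
        (d : ℝ) ^ (-r) * (n : ℝ) ^ (-(r / (d : ℝ))) := by
      rw [← Real.rpow_natCast, ← Real.rpow_mul (by positivity),
        Real.mul_rpow hd0.le (by positivity), ← Real.rpow_mul hn0.le]
      congr 2
      · push_cast; ring
      · push_cast; ring
    rw [hpow, ← mul_assoc, ← mul_assoc] at h
    exact h
end

section
/- Let α > 0 and β > 0. For integers d ≥ 2 and ε ∈ (0,1) define n(ε,d) = min{n ∈ ℕ : exp(−β·k(d,n+1)^α) ≤ ε}. Then: (i) there exist constants c > 0 and t > 0 such that n(ε,d) ≤ c·exp(t·(1+ln ε^{−1})·(1+ln d)) for all integers d ≥ 2 and all ε ∈ (0,1) if and only if α ≥ 1; (ii) if α ≥ 1, then the infimum of all t > 0 for which such a constant c exists equals t₀ = sup_{m ∈ ℕ} m/(1 + β·m^α); in particular, for α = 1 this exponent equals 1/β. -/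
/-- The information complexity `n(ε,d) = min{n ∈ ℕ : exp(−β·k(d,n+1)^α) ≤ ε}` of
the approximation problem `I_d : G^{α,β}(S^d) → L₂(S^d)` for the absolute error
criterion, via an index function `kf` with `kf d n = k(d,n)`. -/
noncomputable def infoComplexityGev (α β : ℝ) (d : ℕ) (kf : ℕ → ℕ → ℕ) (ε : ℝ) : ℕ :=
  sInf {n : ℕ | Real.exp (-β * (kf d (n + 1) : ℝ) ^ α) ≤ ε}

/-- `t` witnesses the quasi-polynomial tractability bound with some constant `c`. -/
def QPTExponent (α β : ℝ) (kf : ℕ → ℕ → ℕ) (t : ℝ) : Prop :=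
  ∃ c : ℝ, 0 < c ∧ ∀ d : ℕ, 2 ≤ d → ∀ ε : ℝ, 0 < ε → ε < 1 →
    (infoComplexityGev α β d kf ε : ℝ) ≤
      c * Real.exp (t * (1 + Real.log ε⁻¹) * (1 + Real.log d))

theorem sphC_eq_choose {d : ℕ} (hd : 0 < d) (k : ℕ) :
    sphC d k = (((k + d).choose d + (k + d - 1).choose d : ℕ) : ℝ) := by
  have hfac : ((k.factorial : ℝ) * d.factorial) ≠ 0 := by positivity
  rw [sphC, div_eq_iff hfac]
  norm_cast
  rcases k with _ | k
  · obtain ⟨d, rfl⟩ : ∃ e, d = e + 1 := ⟨d - 1, by omega⟩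
    simp [Nat.factorial_succ]
  · have h1 := Nat.add_choose_mul_factorial_mul_factorial (k + 1) d
    have h2 := Nat.add_choose_mul_factorial_mul_factorial k d
    have e : k + 1 + d - 1 = k + d := by omega
    have e' : (k + 1 + d).factorial = (k + 1 + d) * (k + d).factorial := by
      rw [add_right_comm, Nat.factorial_succ]
    rw [e'] at h1
    calc (2 * (k + 1) + d) * (k + 1 + d - 1).factorial
        = (k + 1 + d) * (k + d).factorial + (k + 1) * (k + d).factorial := by rw [e]; ring
      _ = (k + 1 + d).choose d * (k + 1).factorial * d.factorial
          + (k + 1) * ((k + d).choose d * k.factorial * d.factorial) := by rw [h1, h2]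
      _ = ((k + 1 + d).choose d + (k + 1 + d - 1).choose d)
          * ((k + 1).factorial * d.factorial) := by rw [e, Nat.factorial_succ]; ring

theorem sphC_mono {d : ℕ} (hd : 0 < d) : Monotone (sphC d) := by
  intro j k hjk
  rw [sphC_eq_choose hd, sphC_eq_choose hd]
  exact_mod_cast Nat.add_le_add (Nat.choose_le_choose d (by omega))
    (Nat.choose_le_choose d (by omega))

theorem choose_add_le_pow (d k : ℕ) : (k + d).choose d ≤ (d + 1) ^ k := by
  rw [← Nat.choose_symm_add]
  induction k with
  | zero => simp
  | succ k ih =>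
    have h := Nat.add_one_mul_choose_eq (k + d) k
    have e : k + 1 + d = k + d + 1 := by omega
    rw [e]
    refine Nat.le_of_mul_le_mul_right (c := k + 1) ?_ k.succ_pos
    rw [← h]
    calc (k + d + 1) * (k + d).choose k
        ≤ ((d + 1) * (k + 1)) * (d + 1) ^ k := Nat.mul_le_mul (by nlinarith) ih
      _ = (d + 1) ^ (k + 1) * (k + 1) := by ring

theorem sphC_le_two_mul_pow {d : ℕ} (hd : 0 < d) (k : ℕ) :
    sphC d k ≤ 2 * ((d : ℝ) + 1) ^ k := by
  rw [sphC_eq_choose hd]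
  have h1 := choose_add_le_pow d k
  have h2 : (k + d - 1).choose d ≤ (k + d).choose d := Nat.choose_le_choose d (by omega)
  exact_mod_cast (by omega : (k + d).choose d + (k + d - 1).choose d ≤ 2 * (d + 1) ^ k)

theorem pow_le_factorial_mul_sphC {d : ℕ} (hd : 0 < d) (k : ℕ) :
    (d : ℝ) ^ k ≤ k.factorial * sphC d k := by
  rw [sphC_eq_choose hd]
  have h : (d + 1) ^ k ≤ k.factorial * (k + d).choose d := by
    have := Nat.pow_sub_le_descFactorial (k + d) k
    rwa [Nat.descFactorial_eq_factorial_mul_choose, Nat.choose_symm_add,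
      (by omega : k + d + 1 - k = d + 1)] at this
  have h' : d ^ k ≤ k.factorial * ((k + d).choose d + (k + d - 1).choose d) :=
    (Nat.pow_le_pow_left d.le_succ k).trans
      (h.trans (Nat.mul_le_mul_left _ (Nat.le_add_right _ _)))
  exact_mod_cast h'

/-- The defining property of `k(d,n)`: the least `k` with `n ≤ C(d,k)`. -/
def IsSphereIndex (kf : ℕ → ℕ → ℕ) : Prop :=
  ∀ d : ℕ, 2 ≤ d → ∀ n : ℕ, 1 ≤ n →
    (n : ℝ) ≤ sphC d (kf d n) ∧ (0 < kf d n → sphC d (kf d n - 1) < (n : ℝ))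

theorem exp_neg_mul_rpow_le_iff {α β ε : ℝ} (hε : 0 < ε) (k : ℕ) :
    Real.exp (-β * (k : ℝ) ^ α) ≤ ε ↔ Real.log ε⁻¹ ≤ β * (k : ℝ) ^ α := by
  rw [← Real.le_log_iff_exp_le hε, Real.log_inv]
  constructor <;> intro h <;> linarith

theorem mem_complexity_set {α β ε : ℝ} (hα : 0 < α) (hβ : 0 < β) {kf : ℕ → ℕ → ℕ}
    (hkf : IsSphereIndex kf) {d : ℕ} (hd : 2 ≤ d) (hε : 0 < ε) {j n : ℕ}
    (hj : Real.log ε⁻¹ ≤ β * ((j + 1 : ℕ) : ℝ) ^ α) (hn : sphC d j ≤ n) :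
    n ∈ {n : ℕ | Real.exp (-β * (kf d (n + 1) : ℝ) ^ α) ≤ ε} := by
  rw [Set.mem_ofPred_eq, exp_neg_mul_rpow_le_iff hε]
  have hlt : j < kf d (n + 1) := by
    by_contra! hle
    have h1 := (hkf d hd (n + 1) (by omega)).1
    have h2 := sphC_mono (by omega : 0 < d) hle
    push_cast at h1
    linarith
  refine hj.trans ?_
  gcongr
  exact hlt

theorem infoComplexityGev_le {α β ε : ℝ} (hα : 0 < α) (hβ : 0 < β) {kf : ℕ → ℕ → ℕ}
    (hkf : IsSphereIndex kf) {d : ℕ} (hd : 2 ≤ d) (hε : 0 < ε) {j : ℕ}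
    (hj : Real.log ε⁻¹ ≤ β * ((j + 1 : ℕ) : ℝ) ^ α) :
    (infoComplexityGev α β d kf ε : ℝ) ≤ sphC d j := by
  have h := mem_complexity_set hα hβ hkf hd hε hj (sphC_eq_choose (by omega) j).le
  rw [sphC_eq_choose (by omega)]
  exact_mod_cast Nat.sInf_le h

theorem exists_le_mul_rpow {α β : ℝ} (hα : 0 < α) (hβ : 0 < β) (L : ℝ) :
    ∃ k : ℕ, L ≤ β * (k : ℝ) ^ α := by
  have h : Filter.Tendsto (fun k : ℕ => β * (k : ℝ) ^ α) Filter.atTop Filter.atTop :=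
    ((tendsto_rpow_atTop hα).comp tendsto_natCast_atTop_atTop).const_mul_atTop hβ
  exact (h.eventually_ge_atTop L).exists

theorem le_infoComplexityGev {α β ε : ℝ} (hα : 0 < α) (hβ : 0 < β) {kf : ℕ → ℕ → ℕ}
    (hkf : IsSphereIndex kf) {d : ℕ} (hd : 2 ≤ d) (hε : 0 < ε) {j : ℕ}
    (hj : β * (j : ℝ) ^ α < Real.log ε⁻¹) :
    sphC d j ≤ (infoComplexityGev α β d kf ε : ℝ) := by
  have hd0 : 0 < d := by omega
  obtain ⟨m, hm⟩ := exists_le_mul_rpow hα hβ (Real.log ε⁻¹)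
  have hm' : Real.log ε⁻¹ ≤ β * ((m + 1 : ℕ) : ℝ) ^ α := hm.trans (by gcongr; omega)
  rw [sphC_eq_choose hd0, Nat.cast_le]
  refine le_csInf ⟨_, mem_complexity_set hα hβ hkf hd hε hm' (sphC_eq_choose hd0 m).le⟩ ?_
  intro n hn
  rw [Set.mem_ofPred_eq, exp_neg_mul_rpow_le_iff hε] at hn
  have hlt : j < kf d (n + 1) := by
    by_contra! hle
    have : β * (kf d (n + 1) : ℝ) ^ α ≤ β * (j : ℝ) ^ α := by gcongr
    linarith
  have h1 := (hkf d hd (n + 1) (by omega)).2 (by omega)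
  have h2 := (sphC_mono hd0 (by omega : j ≤ kf d (n + 1) - 1)).trans_lt h1
  rw [sphC_eq_choose hd0, Nat.cast_lt] at h2
  omega

theorem le_of_forall_pow_le {j : ℕ} {s A : ℝ}
    (h : ∀ d : ℕ, 2 ≤ d → (d : ℝ) ^ j ≤ A * Real.exp (s * (1 + Real.log d))) :
    (j : ℝ) ≤ s := by
  by_contra! hs
  have ht : Filter.Tendsto (fun d : ℕ => (d : ℝ) ^ ((j : ℝ) - s)) Filter.atTop Filter.atTop :=
    (tendsto_rpow_atTop (sub_pos.2 hs)).comp tendsto_natCast_atTop_atTop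
  obtain ⟨d, hd, hd2⟩ := ((ht.eventually_gt_atTop (A * Real.exp s)).and
    (Filter.eventually_ge_atTop 2)).exists
  have hd0 : (0 : ℝ) < d := by exact_mod_cast (by omega : 0 < d)
  have hexp : Real.exp (s * (1 + Real.log d)) = Real.exp s * (d : ℝ) ^ s := by
    rw [Real.rpow_def_of_pos hd0, ← Real.exp_add]
    ring_nf
  have h1 := h d hd2
  rw [hexp, ← mul_assoc] at h1
  rw [Real.rpow_sub hd0, Real.rpow_natCast, lt_div_iff₀ (by positivity)] at hd
  linarith

theorem QPTExponent.div_le {α β t : ℝ} (hα : 0 < α) (hβ : 0 < β) {kf : ℕ → ℕ → ℕ}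
    (hkf : IsSphereIndex kf) (ht : 0 < t) (h : QPTExponent α β kf t) (j : ℕ) :
    (j : ℝ) / (1 + β * (j : ℝ) ^ α) ≤ t := by
  obtain ⟨c, hc, h⟩ := h
  have hj : 0 ≤ β * (j : ℝ) ^ α := by positivity
  rw [div_le_iff₀ (by positivity)]
  refine le_of_forall_pos_le_add fun δ hδ => ?_
  have hL : 0 < β * (j : ℝ) ^ α + δ / t := by positivity
  have hlog : Real.log (Real.exp (-(β * (j : ℝ) ^ α + δ / t)))⁻¹ = β * (j : ℝ) ^ α + δ / t := by
    rw [Real.log_inv, Real.log_exp, neg_neg]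
  have e : t * (1 + β * (j : ℝ) ^ α) + δ = t * (1 + (β * (j : ℝ) ^ α + δ / t)) := by
    field_simp
    ring
  rw [e]
  refine le_of_forall_pow_le (A := j.factorial * c) fun d hd => ?_
  have h1 := h d hd _ (Real.exp_pos _) (Real.exp_lt_one_iff.2 (neg_lt_zero.2 hL))
  have h2 := le_infoComplexityGev hα hβ hkf hd (Real.exp_pos (-(β * (j : ℝ) ^ α + δ / t)))
    (j := j) (by rw [hlog]; linarith [div_pos hδ ht])
  rw [hlog] at h1
  refine (pow_le_factorial_mul_sphC (by omega) j).trans ?_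
  rw [mul_assoc]
  gcongr
  exact h2.trans h1

theorem qptExponent_of_forall_le {α β t : ℝ} (hα : 0 < α) (hβ : 0 < β) {kf : ℕ → ℕ → ℕ}
    (hkf : IsSphereIndex kf) (ht : 0 < t)
    (h : ∀ j : ℕ, (j : ℝ) / (1 + β * (j : ℝ) ^ α) ≤ t) : QPTExponent α β kf t := by
  refine ⟨2, two_pos, fun d hd ε hε hε1 => ?_⟩
  have hL : 0 < Real.log ε⁻¹ := Real.log_pos ((one_lt_inv₀ hε).2 hε1)
  classical
  have hex := exists_le_mul_rpow hα hβ (Real.log ε⁻¹)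
  obtain ⟨j, hj⟩ : ∃ j, Nat.find hex = j + 1 := by
    refine Nat.exists_eq_succ_of_ne_zero fun h0 => ?_
    have := Nat.find_spec hex
    rw [h0, Nat.cast_zero, Real.zero_rpow hα.ne', mul_zero] at this
    linarith
  have hle := Nat.find_spec hex
  rw [hj] at hle
  have hlt : β * (j : ℝ) ^ α < Real.log ε⁻¹ := not_le.1 (Nat.find_min hex (by omega))
  have hd2 : (2 : ℝ) ≤ d := by exact_mod_cast hd
  have hlogd : 0 ≤ Real.log d := Real.log_nonneg (by linarith)
  have hbase : (d : ℝ) + 1 ≤ Real.exp (1 + Real.log d) := by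
    rw [Real.exp_add, Real.exp_log (by linarith)]
    nlinarith [Real.add_one_le_exp (1 : ℝ)]
  have hjt := (div_le_iff₀ (by positivity)).1 (h j)
  calc (infoComplexityGev α β d kf ε : ℝ)
      ≤ sphC d j := infoComplexityGev_le hα hβ hkf hd hε hle
    _ ≤ 2 * ((d : ℝ) + 1) ^ j := sphC_le_two_mul_pow (by omega) j
    _ ≤ 2 * Real.exp (1 + Real.log d) ^ j := by gcongr
    _ = 2 * Real.exp (j * (1 + Real.log d)) := by rw [Real.exp_nat_mul]
    _ ≤ 2 * Real.exp (t * (1 + Real.log ε⁻¹) * (1 + Real.log d)) := by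
      gcongr
      exact hjt.trans (by gcongr)

theorem div_one_add_mul_rpow_le {α β : ℝ} (hα : 1 ≤ α) (hβ : 0 < β) (m : ℕ) :
    (m : ℝ) / (1 + β * (m : ℝ) ^ α) ≤ 1 / β := by
  have hm : (m : ℝ) ≤ (m : ℝ) ^ α := by
    rcases m.eq_zero_or_pos with rfl | hm
    · rw [Nat.cast_zero]
      positivity
    · exact Real.self_le_rpow_of_one_le (by exact_mod_cast hm) hα
  rw [div_le_div_iff₀ (by positivity) hβ]
  nlinarith

theorem one_le_of_forall_div_le {α β t : ℝ} (hα0 : 0 < α) (hβ : 0 < β)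
    (h : ∀ j : ℕ, (j : ℝ) / (1 + β * (j : ℝ) ^ α) ≤ t) : 1 ≤ α := by
  by_contra! hα
  have ht : Filter.Tendsto (fun j : ℕ => (j : ℝ) ^ (1 - α)) Filter.atTop Filter.atTop :=
    (tendsto_rpow_atTop (sub_pos.2 hα)).comp tendsto_natCast_atTop_atTop
  obtain ⟨j, hj, hj1⟩ := ((ht.eventually_gt_atTop (t * (1 + β))).and
    (Filter.eventually_ge_atTop 1)).exists
  have hj1' : (1 : ℝ) ≤ j := by exact_mod_cast hj1
  have hpow : 1 ≤ (j : ℝ) ^ α := Real.one_le_rpow hj1' hα0.le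
  have ht0 : 0 ≤ t := by simpa using h 0
  have hle := (div_le_iff₀ (by positivity)).1 (h j)
  rw [Real.rpow_sub (by linarith), Real.rpow_one, lt_div_iff₀ (by positivity)] at hj
  nlinarith

theorem iSup_div_one_add_mul {β : ℝ} (hβ : 0 < β) :
    ⨆ m : ℕ, (m : ℝ) / (1 + β * (m : ℝ) ^ (1 : ℝ)) = 1 / β := by
  simp only [Real.rpow_one]
  refine ciSup_eq_of_forall_le_of_forall_lt_exists_gt (fun m => ?_) fun w hw => ?_
  · simpa using div_one_add_mul_rpow_le le_rfl hβ m
  · have hw' : 0 < 1 - w * β := by linarith [(lt_div_iff₀ hβ).1 hw]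
    obtain ⟨m, hm⟩ := exists_nat_gt (w / (1 - w * β))
    refine ⟨m, ?_⟩
    rw [div_lt_iff₀ hw'] at hm
    rw [lt_div_iff₀ (by positivity)]
    linarith

/-- Theorem 5.2(3): the approximation problem `I_d : G^{α,β}(S^d) → L₂(S^d)` is
quasi-polynomially tractable if and only if `α ≥ 1`, and for `α ≥ 1` the exponent
of quasi-polynomial tractability is `t₀ = sup_{m ∈ ℕ} m/(1+β·m^α)`; in particular
it equals `1/β` when `α = 1`. -/
theorem gevrey_sphere_quasi_polynomial_tractability
    (α β : ℝ) (hα : 0 < α) (hβ : 0 < β)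
    (kf : ℕ → ℕ → ℕ)
    (hkf : ∀ d : ℕ, 2 ≤ d → ∀ n : ℕ, 1 ≤ n →
      (n : ℝ) ≤ sphC d (kf d n) ∧ (0 < kf d n → sphC d (kf d n - 1) < (n : ℝ))) :
    ((∃ t : ℝ, 0 < t ∧ QPTExponent α β kf t) ↔ 1 ≤ α) ∧
    (1 ≤ α → sInf {t : ℝ | 0 < t ∧ QPTExponent α β kf t} =
      ⨆ m : ℕ, (m : ℝ) / (1 + β * (m : ℝ) ^ α)) ∧
    (α = 1 → sInf {t : ℝ | 0 < t ∧ QPTExponent α β kf t} = 1 / β) := by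
  replace hkf : IsSphereIndex kf := hkf
  have hinf : 1 ≤ α → sInf {t : ℝ | 0 < t ∧ QPTExponent α β kf t} =
      ⨆ m : ℕ, (m : ℝ) / (1 + β * (m : ℝ) ^ α) := by
    intro h
    have hbdd : BddAbove (Set.range fun m : ℕ => (m : ℝ) / (1 + β * (m : ℝ) ^ α)) :=
      ⟨1 / β, Set.forall_mem_range.2 (div_one_add_mul_rpow_le h hβ)⟩
    have hpos : 0 < ⨆ m : ℕ, (m : ℝ) / (1 + β * (m : ℝ) ^ α) :=
      lt_of_lt_of_le (by norm_num; positivity) (le_ciSup hbdd 1)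
    refine IsLeast.csInf_eq ⟨⟨hpos, ?_⟩, fun t ht => ciSup_le (ht.2.div_le hα hβ hkf ht.1)⟩
    exact qptExponent_of_forall_le hα hβ hkf hpos (le_ciSup hbdd)
  refine ⟨⟨?_, fun h => ?_⟩, hinf, ?_⟩
  · rintro ⟨t, ht, hq⟩
    exact one_le_of_forall_div_le hα hβ (hq.div_le hα hβ hkf ht)
  · have ht : 0 < 1 / β := by positivity
    exact ⟨1 / β, ht, qptExponent_of_forall_le hα hβ hkf ht (div_one_add_mul_rpow_le h hβ)⟩
  · rintro rfl
    rw [hinf le_rfl, iSup_div_one_add_mul hβ]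
end

section
/- Let d ≥ 1 be an integer, let 0 < α < 1 and β > 0, and set γ̃ = (1/d!)^{−α/d}. Define a(n) = exp(−β·k̃(d,n)^α) for n ≥ 1. Then lim_{n→∞} exp(β·γ̃·n^{α/d})·a(n) = 1. -/
/-- `D(d,k) = binom(k+d,d)`, the dimension of the space of polynomials of degree at
most `k` on the unit ball `B^d ⊂ ℝ^d`. -/
def ballD (d k : ℕ) : ℕ := (k + d).choose d

theorem factorial_mul_ballD (d k : ℕ) :
    d.factorial * ballD d k = (k + 1).ascFactorial d :=
  (Nat.ascFactorial_eq_factorial_mul_choose k d).symm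

theorem add_rpow_sub_rpow_le {α x y : ℝ} (hα0 : 0 ≤ α) (hα1 : α ≤ 1) (hx : 0 < x)
    (hy : 0 ≤ y) : (x + y) ^ α - x ^ α ≤ α * y * x ^ (α - 1) := by
  have hxy : x + y = x * (1 + y / x) := by field_simp
  have hpos : 0 ≤ y / x := by positivity
  have hle : (1 + y / x) ^ α ≤ 1 + α * (y / x) :=
    rpow_one_add_le_one_add_mul_self (by linarith) hα0 hα1
  rw [hxy, Real.mul_rpow hx.le (by positivity), Real.rpow_sub_one hx.ne']
  calc x ^ α * (1 + y / x) ^ α - x ^ α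
      ≤ x ^ α * (1 + α * (y / x)) - x ^ α := by gcongr
    _ = α * y * (x ^ α / x) := by ring

theorem factorial_mul_le_add_pow {d : ℕ} {kf : ℕ → ℕ}
    (hkf : ∀ n : ℕ, 1 ≤ n →
      n ≤ ballD d (kf n) ∧ (0 < kf n → ballD d (kf n - 1) < n))
    {n : ℕ} (hn : 1 ≤ n) :
    d.factorial * n ≤ (kf n + d) ^ d := by
  calc d.factorial * n ≤ d.factorial * ballD d (kf n) :=
        Nat.mul_le_mul_left _ (hkf n hn).1
    _ = (kf n + 1).ascFactorial d := factorial_mul_ballD d (kf n)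
    _ ≤ (kf n + d) ^ d := Nat.ascFactorial_le_pow_add _ _

theorem pow_le_factorial_mul {d : ℕ} {kf : ℕ → ℕ}
    (hkf : ∀ n : ℕ, 1 ≤ n →
      n ≤ ballD d (kf n) ∧ (0 < kf n → ballD d (kf n - 1) < n))
    {n : ℕ} (hn : 1 ≤ n) (hk : 0 < kf n) :
    kf n ^ d ≤ d.factorial * n := by
  calc kf n ^ d ≤ (kf n).ascFactorial d := by
        obtain ⟨m, hm⟩ := Nat.exists_eq_succ_of_ne_zero hk.ne'
        rw [hm]
        exact Nat.pow_succ_le_ascFactorial _ _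
    _ = d.factorial * ballD d (kf n - 1) := by
        rw [factorial_mul_ballD, Nat.sub_add_cancel hk]
    _ ≤ d.factorial * n := Nat.mul_le_mul_left _ ((hkf n hn).2 hk).le

theorem tendsto_degree_atTop {d : ℕ} {kf : ℕ → ℕ}
    (hkf : ∀ n : ℕ, 1 ≤ n →
      n ≤ ballD d (kf n) ∧ (0 < kf n → ballD d (kf n - 1) < n)) :
    Filter.Tendsto kf Filter.atTop Filter.atTop := by
  refine Filter.tendsto_atTop.2 fun M => ?_
  filter_upwards [Filter.eventually_gt_atTop ((M + d) ^ d)] with n hn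
  by_contra! hM
  have hle := factorial_mul_le_add_pow hkf (n := n) (by omega)
  have hmono : (kf n + d) ^ d ≤ (M + d) ^ d := Nat.pow_le_pow_left (by omega) d
  have hfac : n ≤ d.factorial * n := Nat.le_mul_of_pos_left n d.factorial_pos
  omega

/-- Theorem 6.3: for `0 < α < 1`, `β > 0` and `γ̃ = (1/d!)^{−α/d}`, the sequence
`a(n) = exp(−β·k̃(d,n)^α)` satisfies `exp(β·γ̃·n^{α/d})·a(n) → 1`, where `k̃(d,n)`
is the unique `k` with `D(d,k−1) < n ≤ D(d,k)` (with `D(d,−1) = 0`). -/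
theorem strong_equivalence_gevrey_ball
    (d : ℕ) (hd : 1 ≤ d) (α β : ℝ) (hα0 : 0 < α) (hα1 : α < 1) (hβ : 0 < β)
    (γ : ℝ) (hγ : γ = (1 / (Nat.factorial d : ℝ)) ^ (-(α / (d : ℝ))))
    (kf : ℕ → ℕ)
    (hkf : ∀ n : ℕ, 1 ≤ n →
      n ≤ ballD d (kf n) ∧ (0 < kf n → ballD d (kf n - 1) < n)) :
    Filter.Tendsto
      (fun n : ℕ => Real.exp (β * γ * (n : ℝ) ^ (α / (d : ℝ))) *
        Real.exp (-β * (kf n : ℝ) ^ α))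
      Filter.atTop (nhds 1) := by
  have hd0 : (d : ℝ) ≠ 0 := by exact_mod_cast (by omega : d ≠ 0)
  have hk := tendsto_degree_atTop hkf
  have hγn : ∀ n : ℕ, γ * (n : ℝ) ^ (α / (d : ℝ)) =
      ((d.factorial * n : ℕ) : ℝ) ^ (α / (d : ℝ)) := by
    intro n
    rw [hγ, one_div, Real.inv_rpow (by positivity), Real.rpow_neg (by positivity), inv_inv,
      Nat.cast_mul, Real.mul_rpow (by positivity) (by positivity)]
  have hroot : ∀ m : ℕ, ((m ^ d : ℕ) : ℝ) ^ (α / (d : ℝ)) = (m : ℝ) ^ α := by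
    intro m
    rw [Nat.cast_pow, ← Real.rpow_natCast_mul (by positivity), mul_div_cancel₀ _ hd0]
  have hbound : Filter.Tendsto (fun n : ℕ => α * d * (kf n : ℝ) ^ (α - 1))
      Filter.atTop (nhds 0) := by
    have hpow := (tendsto_rpow_neg_atTop (sub_pos.2 hα1)).comp
      (tendsto_natCast_atTop_atTop.comp hk)
    simpa [Function.comp_def] using hpow.const_mul (α * d)
  have hdiff : Filter.Tendsto
      (fun n : ℕ => γ * (n : ℝ) ^ (α / (d : ℝ)) - (kf n : ℝ) ^ α)
      Filter.atTop (nhds 0) := by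
    refine tendsto_of_tendsto_of_tendsto_of_le_of_le' tendsto_const_nhds hbound ?_ ?_
    · filter_upwards [Filter.eventually_ge_atTop 1, hk.eventually_gt_atTop 0] with n hn hkn
      rw [hγn, ← hroot, sub_nonneg]
      have hle := pow_le_factorial_mul hkf hn hkn
      gcongr
    · filter_upwards [Filter.eventually_ge_atTop 1, hk.eventually_gt_atTop 0] with n hn hkn
      refine le_trans ?_ (add_rpow_sub_rpow_le hα0.le hα1.le (Nat.cast_pos.2 hkn)
        (Nat.cast_nonneg d))
      rw [hγn, ← Nat.cast_add, ← hroot (kf n + d)]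
      have hle := factorial_mul_le_add_pow hkf hn
      gcongr
  have hexp := (Real.continuous_exp.tendsto _).comp (hdiff.const_mul β)
  rw [mul_zero, Real.exp_zero] at hexp
  refine hexp.congr fun n => ?_
  rw [Function.comp_apply, ← Real.exp_add]
  congr 1
  ring
end
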